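/- arXiv:1908.09793 — 4 statements merged into one kernel-verified Lean document; each statement's English description precedes it below -/
import Mathlib

section
/- Fix n > 2. For every integer b such that both b and n^n + (1−n)^{n−1} b are square-free and b is not 0 or ±1, the polynomial f(x) = x^n + b x + b is irreducible over ℚ and, for a root θ, ℤ[θ] is the full ring of integers of ℚ(θ). Moreover, there are infinitely many such b. -/
open Polynomial NumberField

/-- The index of the order `ℤ[θ]` in the ring of integers of `K`. -/
noncomputable def indexZTheta {K : Type*} [Field K] [NumberField K]
    (θ : NumberField.RingOfIntegers K) : ℕ :=
  (Algebra.adjoin ℤ ({θ} : Set (NumberField.RingOfIntegers K))).toSubring.toAddSubgroup.index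


lemma s16_primeSum (m : ℕ) : ∑ k ∈ Finset.range (2 * (m + 2)),
    (if k.Prime then (1 / (k : ℚ) ^ 2) else 0) ≤ 35 / 72 - 1 / (4 * ((m : ℚ) + 2)) := by
  induction m with
  | zero => norm_num [Finset.sum_range_succ]
  | succ m ih =>
    have e : 2 * (m + 1 + 2) = 2 * (m + 2) + 1 + 1 := by ring
    rw [e, Finset.sum_range_succ, Finset.sum_range_succ]
    have h1 : ¬ (2 * (m + 2)).Prime := Nat.not_prime_mul (by norm_num) (by omega)
    rw [if_neg h1]
    have h2 : (if (2 * (m + 2) + 1).Prime then (1 / ((2 * (m + 2) + 1 : ℕ) : ℚ) ^ 2) else 0)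
        ≤ 1 / (4 * ((m : ℚ) + 2)) - 1 / (4 * (((m + 1 : ℕ) : ℚ) + 2)) := by
      have h3 : 1 / ((2 * (m + 2) + 1 : ℕ) : ℚ) ^ 2 
        ≤ 1 / (4 * ((m : ℚ) + 2)) - 1 / (4 * (((m + 1 : ℕ) : ℚ) + 2)) := by
        push_cast
        rw [div_sub_div _ _ (by positivity) (by positivity), div_le_div_iff₀ (by positivity) (by positivity)]
        have : (0 : ℚ) ≤ m := by positivity
        nlinarith [this]
      split_ifs
      · exact h3
      · exact le_trans (by positivity) h3
    linarith

lemma s16_primeSum' (B : ℕ) : ∑ k ∈ (Finset.range B).filter Nat.Prime, (1 / (k : ℚ) ^ 2) ≤ 35 / 72 := by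
  rw [Finset.sum_filter]
  refine le_trans (Finset.sum_le_sum_of_subset_of_nonneg (t := Finset.range (2 * (B + 2))) ?_ ?_) ?_
  · intro x; simp only [Finset.mem_range]; omega
  · intros; positivity
  · refine (s16_primeSum B).trans ?_
    have : (0:ℚ) ≤ 1 / (4 * ((B : ℚ) + 2)) := by positivity
    linarith

lemma s16_count (A M : ℤ) (h : IsCoprime A M) (N p : ℕ) (hp : p.Prime) :
    ((((Finset.Ioc (0 : ℤ) N).filter (fun b => (p : ℤ) ^ 2 ∣ A + M * b)).card : ℕ) : ℚ)
      ≤ N * (1 / (p : ℚ) ^ 2) + 1 := by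
  have hp0 : (0 : ℚ) < p := by exact_mod_cast hp.pos
  rcases Finset.eq_empty_or_nonempty
    ((Finset.Ioc (0 : ℤ) N).filter (fun b => (p : ℤ) ^ 2 ∣ A + M * b)) with he | ⟨b₀, hb₀⟩
  · rw [he]; simp; positivity
  · simp only [Finset.mem_filter, Finset.mem_Ioc] at hb₀
    have hpi : Prime (p : ℤ) := Nat.prime_iff_prime_int.mp hp
    have hpM : ¬ (p : ℤ) ∣ M := by
      intro hM
      have h1 : (p : ℤ) ∣ A + M * b₀ := (dvd_pow_self _ two_ne_zero).trans hb₀.2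
      have h2 : (p : ℤ) ∣ A := (dvd_add_left (hM.mul_right _)).1 h1
      exact hpi.not_isUnit (h.isUnit_of_dvd' h2 hM)
    have hc : IsCoprime ((p : ℤ) ^ 2) M :=
      (((Prime.coprime_iff_not_dvd hpi).2 hpM)).pow_left
    have hs : (Finset.Ioc (0 : ℤ) N).filter (fun b => (p : ℤ) ^ 2 ∣ A + M * b) ⊆
        (Finset.Ioc (0 : ℤ) N).filter (fun b => b ≡ b₀ [ZMOD (p : ℤ) ^ 2]) := by
      intro b hb
      simp only [Finset.mem_filter, Finset.mem_Ioc] at hb ⊢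
      refine ⟨hb.1, ?_⟩
      have h3 := dvd_sub hb₀.2 hb.2
      have h4 : (p : ℤ) ^ 2 ∣ M * (b₀ - b) := by
        rwa [show A + M * b₀ - (A + M * b) = M * (b₀ - b) by ring] at h3
      exact Int.modEq_iff_dvd.2 (hc.dvd_of_dvd_mul_left h4)
    have hr : (0 : ℤ) < (p : ℤ) ^ 2 := by have := hp.pos; positivity
    have h5 := Int.Ioc_filter_modEq_card (0 : ℤ) N hr b₀
    have h6 : ((((Finset.Ioc (0 : ℤ) N).filter (fun b => b ≡ b₀ [ZMOD (p : ℤ) ^ 2])).card : ℤ) : ℚ)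
      ≤ N * (1 / (p : ℚ) ^ 2) + 1 := by
      rw [h5]
      push_cast
      refine max_le ?_ (by positivity)
      have h7 := Int.floor_le (((N : ℚ) - b₀) / (p : ℚ) ^ 2)
      have h8 := Int.lt_floor_add_one (((0 : ℚ) - b₀) / (p : ℚ) ^ 2)
      have h9 : ((N : ℚ) - b₀) / (p : ℚ) ^ 2 - ((0 : ℚ) - b₀) / (p : ℚ) ^ 2 = N * (1 / (p : ℚ) ^ 2) := by
        ring
      linarith
    refine le_trans ?_ h6
    exact_mod_cast Finset.card_le_card hs

open Classical in
lemma s16_bad (A M : ℤ) (h : IsCoprime A M) (N B : ℕ) (hB2 : 2 ≤ B)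
    (hB : |A| + |M| * N ≤ (B : ℤ) ^ 2) :
    ((((Finset.Ioc (0 : ℤ) N).filter (fun b => ¬ Squarefree (A + M * b))).card : ℕ) : ℚ)
      ≤ N * (35 / 72) + (B + 1) := by
  set P := (Finset.range (B + 1)).filter Nat.Prime with hP
  have hsub : (Finset.Ioc (0 : ℤ) N).filter (fun b => ¬ Squarefree (A + M * b)) ⊆
      P.biUnion (fun p => (Finset.Ioc (0 : ℤ) N).filter (fun b => (p : ℤ) ^ 2 ∣ A + M * b)) := by
    intro b hb
    simp only [Finset.mem_filter, Finset.mem_Ioc, Finset.mem_biUnion, hP, Finset.mem_range] at hb ⊢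
    obtain ⟨hb1, hb2⟩ := hb
    by_cases h0 : A + M * b = 0
    · exact ⟨2, ⟨by omega, Nat.prime_two⟩, hb1, by rw [h0]; exact dvd_zero _⟩
    · rw [← Int.squarefree_natAbs, Nat.squarefree_iff_prime_squarefree] at hb2
      push Not at hb2
      obtain ⟨p, hp, hpd⟩ := hb2
      have hd : (p : ℤ) ^ 2 ∣ A + M * b := by
        rw [← Int.natCast_dvd] at hpd
        rw [pow_two]; exact_mod_cast hpd
      refine ⟨p, ⟨?_, hp⟩, hb1, hd⟩
      have h1 : (p : ℤ) ^ 2 ≤ |A + M * b| := Int.le_of_dvd (abs_pos.2 h0) ((dvd_abs _ _).2 hd)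
      have h2 : |A + M * b| ≤ |A| + |M| * N := by
        refine (abs_add_le _ _).trans ?_
        rw [abs_mul, abs_of_pos hb1.1]
        have := mul_le_mul_of_nonneg_left hb1.2 (abs_nonneg M)
        linarith
      have h3 : (p : ℤ) ^ 2 ≤ (B : ℤ) ^ 2 := by linarith
      have h4 : p ^ 2 ≤ B ^ 2 := by exact_mod_cast h3
      have := (Nat.pow_le_pow_iff_left two_ne_zero).1 h4
      omega
  have h1 := (Finset.card_le_card hsub).trans Finset.card_biUnion_le
  calc ((((Finset.Ioc (0 : ℤ) N).filter (fun b => ¬ Squarefree (A + M * b))).card : ℕ) : ℚ)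
      ≤ ∑ p ∈ P, ((((Finset.Ioc (0 : ℤ) N).filter (fun b => (p : ℤ) ^ 2 ∣ A + M * b)).card : ℕ) : ℚ) := by
        exact_mod_cast h1
    _ ≤ ∑ p ∈ P, ((N : ℚ) * (1 / (p : ℚ) ^ 2) + 1) := by
        refine Finset.sum_le_sum fun p hp => s16_count A M h N p ?_
        exact (Finset.mem_filter.1 hp).2
    _ = N * (∑ p ∈ P, (1 / (p : ℚ) ^ 2)) + P.card := by
        rw [Finset.sum_add_distrib, Finset.mul_sum]; simp
    _ ≤ N * (35 / 72) + (B + 1) := by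
        have := s16_primeSum' (B + 1)
        have h2 : P.card ≤ B + 1 := by
          simpa using Finset.card_filter_le (Finset.range (B + 1)) Nat.Prime
        have h3 : (P.card : ℚ) ≤ B + 1 := by exact_mod_cast h2
        gcongr

open Classical in
lemma s16_infinite (A M : ℤ) (h : IsCoprime A M) :
    {b : ℤ | Squarefree b ∧ Squarefree (A + M * b) ∧ b ≠ 0 ∧ b ≠ 1 ∧ b ≠ -1}.Infinite := by
  intro hfin
  set T := hfin.toFinset with hT
  set L : ℕ := A.natAbs + M.natAbs + 2 with hL
  set t : ℕ := 36 * (T.card + 3) + 72 * L + 1 with ht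
  set N : ℕ := t ^ 2 with hN
  have ht1 : 1 ≤ t := by omega
  have hLt : 2 ≤ L * t := by
    have hL2 : 2 ≤ L := by omega
    exact hL2.trans (Nat.le_mul_of_pos_right L ht1)
  have hbd : ∀ A' M' : ℤ, A'.natAbs + M'.natAbs ≤ L → |A'| + |M'| * N ≤ ((L * t : ℕ) : ℤ) ^ 2 := by
    intro A' M' hh
    rw [Int.abs_eq_natAbs, Int.abs_eq_natAbs]
    norm_cast
    have : 1 ≤ t ^ 2 := Nat.one_le_pow _ _ ht1
    calc A'.natAbs + M'.natAbs * N ≤ (A'.natAbs + M'.natAbs) * t ^ 2 := by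
          rw [hN, add_mul]; exact Nat.add_le_add_right (Nat.le_mul_of_pos_right _ this) _
      _ ≤ L * t ^ 2 := Nat.mul_le_mul_right _ hh
      _ ≤ (L * t) ^ 2 := by
        rw [mul_pow]; exact Nat.mul_le_mul_right _ (Nat.le_self_pow two_ne_zero L)
  have h1 := s16_bad 0 1 isCoprime_one_right N (L * t) hLt (hbd _ _ (by simp; omega))
  have h2 := s16_bad A M h N (L * t) hLt (hbd _ _ (by omega))
  have hsub : Finset.Ioc (0 : ℤ) N ⊆
      ((Finset.Ioc (0 : ℤ) N).filter (fun b => ¬ Squarefree (0 + 1 * b))) ∪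
      ((Finset.Ioc (0 : ℤ) N).filter (fun b => ¬ Squarefree (A + M * b))) ∪ (insert 1 T) := by
    intro b hb
    have hb' := Finset.mem_Ioc.1 hb
    simp only [Finset.mem_union, Finset.mem_filter, Finset.mem_insert, hT, Set.Finite.mem_toFinset,
      Set.mem_ofPred_eq, hb, true_and, zero_add, one_mul]
    by_cases c1 : Squarefree b <;> by_cases c2 : Squarefree (A + M * b) <;> simp [c1, c2]
    by_cases c3 : b = 1
    · simp [c3]
    · right; omega
  have h3 := Finset.card_le_card hsub
  have h4 := h3.trans ((Finset.card_union_le _ _).trans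
    (Nat.add_le_add (Finset.card_union_le _ _) (Finset.card_insert_le _ _)))
  rw [Int.card_Ioc] at h4
  have h5 : (N : ℚ) ≤ (N * (35 / 72) + ((L * t : ℕ) + 1)) + (N * (35 / 72) + ((L * t : ℕ) + 1)) + (T.card + 1) := by
    rw [sub_zero, Int.toNat_natCast] at h4
    have h6 := (Nat.cast_le (α := ℚ)).2 h4
    push_cast at h1 h2 h6 ⊢
    linarith
  have h7 : N ≤ 72 * (L * t) + 36 * (T.card + 3) := by
    have : (N : ℚ) ≤ 72 * (L * t : ℕ) + 36 * (T.card + 3) := by linarith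
    exact_mod_cast this
  have h8 : N = 36 * (T.card + 3) * t + 72 * (L * t) + t := by
    rw [hN, pow_two]; conv_lhs => rw [ht]
    ring_nf
    rw [ht]; ring
  have h9 : 36 * (T.card + 3) * 1 ≤ 36 * (T.card + 3) * t := Nat.mul_le_mul_left _ ht1
  omega

lemma s16_deg (n : ℕ) (hn : 2 < n) (b : ℤ) : (X ^ n + C b * X + C b : ℤ[X]).natDegree = n := by
  rw [add_assoc]
  have h : (C b * X + C b : ℤ[X]).natDegree < (X ^ n : ℤ[X]).natDegree := by
    rw [natDegree_X_pow]
    exact lt_of_le_of_lt natDegree_linear_le (by omega)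
  rw [natDegree_add_eq_left_of_natDegree_lt h, natDegree_X_pow]

lemma s16_monic (n : ℕ) (hn : 2 < n) (b : ℤ) : (X ^ n + C b * X + C b : ℤ[X]).Monic := by
  rw [add_assoc]
  refine monic_X_pow_add ?_
  exact lt_of_le_of_lt degree_linear_le (by exact_mod_cast (by omega : 1 < n))

lemma s16_eis (n : ℕ) (hn : 2 < n) (b : ℤ) (hb : Squarefree b) (p : ℤ) (hp : Prime p) (hpb : p ∣ b) :
    (X ^ n + C b * X + C b : ℤ[X]).IsEisensteinAt (Ideal.span {p}) := by
  refine (s16_monic n hn b).isEisensteinAt_of_mem_of_notMem ?_ ?_ ?_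
  · rw [Ne, Ideal.span_singleton_eq_top]; exact hp.not_isUnit
  · intro k hk
    rw [s16_deg n hn] at hk
    rw [Ideal.mem_span_singleton]
    simp only [coeff_add, coeff_X_pow, coeff_C_mul, coeff_C, coeff_X]
    rw [if_neg hk.ne]
    refine dvd_add (dvd_add (dvd_zero _) (hpb.mul_right _)) ?_
    split_ifs
    · exact hpb
    · exact dvd_zero _
  · rw [Ideal.span_singleton_pow, Ideal.mem_span_singleton]
    simp only [coeff_add, coeff_X_pow, coeff_C_mul, coeff_C, coeff_X]
    rw [if_neg (by omega)]
    simp only [one_ne_zero, if_false, if_true, mul_zero, zero_add]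
    intro h
    rw [pow_two] at h
    exact hp.not_isUnit (hb p h)

lemma s16_irred (n : ℕ) (hn : 2 < n) (b : ℤ) (hb : Squarefree b) (h1 : b ≠ 1) (h2 : b ≠ -1) :
    Irreducible (X ^ n + C b * X + C b : ℤ[X]) := by
  obtain ⟨p, hp, hpb⟩ : ∃ p : ℤ, Prime p ∧ p ∣ b := by
    have : b.natAbs ≠ 1 := by omega
    obtain ⟨p, hp, h⟩ := Nat.exists_prime_and_dvd this
    exact ⟨p, Nat.prime_iff_prime_int.1 hp, Int.natCast_dvd.2 h⟩
  refine (s16_eis n hn b hb p hp hpb).irreducible ?_ (s16_monic n hn b).isPrimitive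
    (by rw [s16_deg n hn]; omega)
  exact (Ideal.span_singleton_prime hp.ne_zero).2 hp

lemma s16_norm_sub {K : Type} [Field K] [NumberField K] (B : PowerBasis ℚ K) (t : ℚ) :
    Algebra.norm ℚ (algebraMap ℚ K t - B.gen) = (minpoly ℚ B.gen).eval t := by
  rw [← charpoly_leftMulMatrix, Matrix.eval_charpoly, Algebra.norm_eq_matrix_det B.basis, map_sub]
  congr 2
  exact AlgHom.commutes _ _

lemma s16_discr (n : ℕ) (hn : 2 < n) (b : ℤ) (hb0 : b ≠ 0) {K : Type} [Field K] [NumberField K]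
    (B : PowerBasis ℚ K)
    (hmin : minpoly ℚ B.gen = (X ^ n + C b * X + C b : ℤ[X]).map (Int.castRingHom ℚ)) :
    ∃ s : ℤ, IsUnit s ∧ Algebra.discr ℚ B.basis =
      ((s * (b ^ (n - 1) * ((n : ℤ) ^ n + (1 - (n : ℤ)) ^ (n - 1) * b)) : ℤ) : ℚ) := by
  have hdim : Module.finrank ℚ K = n := by
    rw [B.finrank, ← B.natDegree_minpoly, hmin, (s16_monic n hn b).natDegree_map, s16_deg n hn]
  have hmin' : minpoly ℚ B.gen = X ^ n + C (b : ℚ) * X + C (b : ℚ) := by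
    rw [hmin]; simp
  obtain ⟨m, rfl⟩ : ∃ m, n = m + 1 := ⟨n - 1, by omega⟩
  have hroot : B.gen ^ (m + 1) + (b : K) * B.gen + b = 0 := by
    have := minpoly.aeval ℚ B.gen
    rw [hmin'] at this
    simpa using this
  have hder : aeval B.gen (derivative (minpoly ℚ B.gen)) = ((m : K) + 1) * B.gen ^ m + b := by
    rw [hmin']; simp
  have hm0 : (m : ℚ) ≠ 0 := by have : m ≠ 0 := by omega
                               exact_mod_cast this
  have hbq : (b : ℚ) ≠ 0 := by exact_mod_cast hb0
  have hkey : (algebraMap ℚ K 0 - B.gen) * aeval B.gen (derivative (minpoly ℚ B.gen)) =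
      algebraMap ℚ K (-(b * m)) * (algebraMap ℚ K (-((m : ℚ) + 1) / m) - B.gen) := by
    have : (algebraMap ℚ K m) ≠ 0 := by simpa using hm0
    rw [hder]
    simp only [map_div₀, map_neg, map_add, map_one, map_mul, map_zero]
    simp only [map_natCast, map_intCast] at this ⊢
    field_simp
    linear_combination (-(m : K) - 1) * hroot
  have hN0 := s16_norm_sub B 0
  have hNt := s16_norm_sub B (-((m : ℚ) + 1) / m)
  rw [hmin'] at hN0 hNt
  have hn1 := congrArg (Algebra.norm ℚ) hkey
  rw [map_mul, map_mul, hN0, hNt, Algebra.norm_algebraMap, hdim] at hn1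
  have hN : Algebra.norm ℚ (aeval B.gen (derivative (minpoly ℚ B.gen))) =
     (-1) ^ (m + 1) * b ^ m * (-1) ^ (m + 1) * (((m : ℚ) + 1) ^ (m + 1) + (-(m : ℚ)) ^ m * b) := by
    simp only [eval_add, eval_mul, eval_pow, eval_X, eval_C, zero_pow (Nat.succ_ne_zero m), mul_zero, zero_add] at hn1
    apply mul_left_cancel₀ hbq
    rw [hn1]
    have e : (-((m : ℚ) + 1) / m) ^ (m + 1) = (-1) ^ (m + 1) * ((m : ℚ) + 1) ^ (m + 1) / (m : ℚ) ^ (m + 1) := by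
      rw [div_pow, neg_pow]
    rw [e, neg_pow ((b : ℚ) * m), neg_pow (m : ℚ)]
    have e2 : ((-1 : ℚ)) ^ m * (-1) ^ m = 1 := by rw [← mul_pow]; simp
    simp only [mul_pow, pow_succ (-1 : ℚ)]
    field_simp
    ring_nf
    ring_nf at e2
    have e3 : ((-1 : ℚ)) ^ (m * 3) = (-1) ^ m := by
      rw [show m * 3 = m * 2 + m by ring, pow_add, e2, one_mul]
    simp only [e2, e3]
    ring
  refine ⟨(-1) ^ ((m + 1) * (m + 1 - 1) / 2), (isUnit_one.neg).pow _, ?_⟩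
  rw [Algebra.discr_powerBasis_eq_norm, hN, hdim]
  push_cast
  have e2 : ((-1 : ℚ)) ^ m * (-1) ^ m = 1 := by rw [← mul_pow]; simp
  rw [show (1 : ℚ) - (m + 1) = - m by ring]
  simp only [pow_succ (-1 : ℚ)]
  linear_combination (((-1 : ℚ)) ^ ((m + 1) * m / 2) * b ^ m * (((m : ℚ) + 1) ^ (m + 1) + (-(m : ℚ)) ^ m * b)) * e2

lemma s16_trans {K : Type} [Field K] [NumberField K] (θ : 𝓞 K) (n : ℕ) (B : PowerBasis ℚ K)
    (hB : B.gen = θ) :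
    ∃ d e : ℤ, Algebra.discr ℚ B.basis = ((d ^ 2 * e : ℤ) : ℚ) ∧
      ∀ z : 𝓞 K, d • z ∈ Algebra.adjoin ℤ ({θ} : Set (𝓞 K)) := by
  have hcard : Module.finrank ℤ (𝓞 K) = B.dim := by
    rw [RingOfIntegers.rank, B.finrank]
  let c : Module.Basis (Fin B.dim) ℤ (𝓞 K) := Module.finBasisOfFinrankEq ℤ (𝓞 K) hcard
  let v : Fin B.dim → 𝓞 K := fun i => θ ^ (i : ℕ)
  let P := c.toMatrix v
  refine ⟨P.det, Algebra.discr ℤ c, ?_, ?_⟩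
  · rw [← Algebra.discr_of_matrix_vecMul, Module.Basis.toMatrix_map_vecMul,
      Algebra.discr_def, Algebra.discr_def]
    rw [Int.cast_det]
    congr 1
    ext i j
    simp only [Algebra.traceMatrix_apply, Algebra.traceForm_apply, Matrix.map_apply, 
      B.basis_eq_pow, hB, v]
    have := Algebra.trace_localization ℤ (nonZeroDivisors ℤ) (Rₘ := ℚ) (Sₘ := K)
      (θ ^ (i : ℕ) * θ ^ (j : ℕ))
    simpa using this
  · intro z
    have hmem : ∀ i, P.det • c i ∈ Algebra.adjoin ℤ ({θ} : Set (𝓞 K)) := by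
      intro i
      have h1 : P.det • c i = ∑ j, P.adjugate j i • v j := by
        have h2 : ∀ j, v j = ∑ k, P k j • c k := fun j => (c.sum_toMatrix_smul_self v j).symm
        simp only [h2, Finset.smul_sum, smul_smul]
        rw [Finset.sum_comm]
        simp only [← Finset.sum_smul]
        have h3 : ∀ k, ∑ j, P.adjugate j i * P k j = (P * P.adjugate) k i := by
          intro k
          rw [Matrix.mul_apply]
          exact Finset.sum_congr rfl fun _ _ => mul_comm _ _
        simp only [h3, Matrix.mul_adjugate]
        simp [Matrix.one_apply]
      rw [h1]
      refine Subalgebra.sum_mem _ fun j _ => Subalgebra.smul_mem _ ?_ _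
      exact Subalgebra.pow_mem _ (Algebra.self_mem_adjoin_singleton ℤ θ) _
    rw [← c.sum_repr z, Finset.smul_sum]
    refine Subalgebra.sum_mem _ fun j _ => ?_
    rw [smul_comm]
    exact Subalgebra.smul_mem _ (hmem j) _

lemma s16_main (n : ℕ) (hn : 2 < n) (b : ℤ) (hb : Squarefree b)
    (hD : Squarefree ((n : ℤ) ^ n + (1 - (n : ℤ)) ^ (n - 1) * b))
    (hb0 : b ≠ 0) (hb1 : b ≠ 1) (hb2 : b ≠ -1)
    (K : Type) [Field K] [NumberField K] (θ : 𝓞 K)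
    (hθ : Polynomial.aeval θ (X ^ n + C b * X + C b : ℤ[X]) = 0)
    (htop : Algebra.adjoin ℚ ({(θ : K)} : Set K) = ⊤) :
    Algebra.adjoin ℤ ({θ} : Set (𝓞 K)) = ⊤ := by
  have hmonic := s16_monic n hn b
  have hirr := s16_irred n hn b hb hb1 hb2
  have hintθ : IsIntegral ℤ (θ : K) := θ.isIntegral_coe
  let B : PowerBasis ℚ K := PowerBasis.ofAdjoinEqTop (hintθ.tower_top (A := ℚ)) htop
  have hB : B.gen = (θ : K) := PowerBasis.ofAdjoinEqTop_gen _ _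
  have hmapirr : Irreducible ((X ^ n + C b * X + C b : ℤ[X]).map (Int.castRingHom ℚ)) :=
    (hmonic.irreducible_iff_irreducible_map_fraction_map (K := ℚ)).1 hirr
  have hroot : aeval (θ : K) (X ^ n + C b * X + C b : ℤ[X]) = 0 := by
    have := congrArg (algebraMap (𝓞 K) K) hθ
    rwa [← aeval_algebraMap_apply, map_zero] at this
  have hminQ : minpoly ℚ B.gen = (X ^ n + C b * X + C b : ℤ[X]).map (Int.castRingHom ℚ) := by
    rw [hB]
    refine (minpoly.eq_of_irreducible_of_monic hmapirr ?_ (hmonic.map _)).symm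
    exact (aeval_map_algebraMap ℚ (θ : K) _).trans hroot
  have hminZ : minpoly ℤ B.gen = X ^ n + C b * X + C b := by
    have h1 := minpoly.isIntegrallyClosed_eq_field_fractions' ℚ (hB ▸ hintθ : IsIntegral ℤ B.gen)
    rw [hminQ] at h1
    exact (Polynomial.map_injective _ Int.cast_injective h1).symm
  obtain ⟨s, hs, hdisc⟩ := s16_discr n hn b hb0 B hminQ
  obtain ⟨d, e, hde, hmem⟩ := s16_trans θ n B hB
  have heq : d ^ 2 * e = s * (b ^ (n - 1) * ((n : ℤ) ^ n + (1 - (n : ℤ)) ^ (n - 1) * b)) := by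
    rw [hdisc] at hde; exact_mod_cast hde.symm
  have hDne := hD.ne_zero
  have hd0 : d ≠ 0 := by
    rintro rfl
    rw [zero_pow two_ne_zero, zero_mul] at heq
    exact (mul_ne_zero hs.ne_zero (mul_ne_zero (pow_ne_zero _ hb0) hDne)) heq.symm
  have hpd : ∀ p : ℤ, Prime p → p ∣ d → p ∣ b := by
    intro p hp hpd
    by_contra hpb
    have h1 : p ^ 2 ∣ s * (b ^ (n - 1) * ((n : ℤ) ^ n + (1 - (n : ℤ)) ^ (n - 1) * b)) :=
      heq ▸ (pow_dvd_pow_of_dvd hpd 2).mul_right e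
    rw [hs.dvd_mul_left] at h1
    have hc : IsCoprime (p ^ 2) (b ^ (n - 1)) := ((Prime.coprime_iff_not_dvd hp).2 hpb).pow
    have h2 := hc.dvd_of_dvd_mul_left h1
    rw [pow_two] at h2
    exact hp.not_isUnit (hD p h2)
  have hadj : ∀ z : 𝓞 K, (z : K) ∈ Algebra.adjoin ℤ ({(θ : K)} : Set K) ↔
      z ∈ Algebra.adjoin ℤ ({θ} : Set (𝓞 K)) := by
    intro z
    have : Algebra.adjoin ℤ ({(θ : K)} : Set K) =
        (Algebra.adjoin ℤ ({θ} : Set (𝓞 K))).map (IsScalarTower.toAlgHom ℤ (𝓞 K) K) := by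
      rw [AlgHom.map_adjoin, Set.image_singleton]; rfl
    rw [this, Subalgebra.mem_map]
    constructor
    · rintro ⟨y, hy, hyz⟩
      have : y = z := RingOfIntegers.coe_injective hyz
      exact this ▸ hy
    · intro h; exact ⟨z, h, rfl⟩
  have hstep : ∀ p : ℤ, Prime p → p ∣ b → ∀ z : 𝓞 K,
      p • z ∈ Algebra.adjoin ℤ ({θ} : Set (𝓞 K)) → z ∈ Algebra.adjoin ℤ ({θ} : Set (𝓞 K)) := by
    intro p hp hpb z hz
    rw [← hadj] at hz ⊢
    rw [← hB] at hz ⊢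
    refine mem_adjoin_of_smul_prime_smul_of_minpoly_isEisensteinAt hp (hB ▸ hintθ)
      z.isIntegral_coe ?_ (hminZ ▸ s16_eis n hn b hb p hp hpb)
    simpa using hz
  have hall : ∀ d : ℤ, d ≠ 0 → (∀ p : ℤ, Prime p → p ∣ d → p ∣ b) → ∀ z : 𝓞 K,
      d • z ∈ Algebra.adjoin ℤ ({θ} : Set (𝓞 K)) → z ∈ Algebra.adjoin ℤ ({θ} : Set (𝓞 K)) := by
    intro d
    induction d using UniqueFactorizationMonoid.induction_on_prime with
    | h₁ => intro h; exact absurd rfl h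
    | h₂ u hu =>
      intro _ _ z hz
      obtain ⟨w, hw⟩ := hu.exists_left_inv
      have := Subalgebra.smul_mem _ hz w
      rwa [smul_smul, hw, one_smul] at this
    | h₃ a p ha hp ih =>
      intro h0 hdiv z hz
      rw [mul_smul] at hz
      exact ih ha (fun q hq hqa => hdiv q hq (hqa.mul_left _)) z
        (hstep p hp (hdiv p hp (dvd_mul_right _ _)) _ hz)
  exact Algebra.eq_top_iff.2 fun z => hall d hd0 hpd z (hmem z)

theorem stmt16 (n : ℕ) (hn : 2 < n) :
    (∀ b : ℤ, Squarefree b → Squarefree ((n : ℤ) ^ n + (1 - (n : ℤ)) ^ (n - 1) * b) →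
      b ≠ 0 → b ≠ 1 → b ≠ -1 →
      Irreducible ((X ^ n + C b * X + C b : ℤ[X]).map (Int.castRingHom ℚ)) ∧
      ∀ (K : Type) [Field K] [NumberField K] (θ : NumberField.RingOfIntegers K),
        Polynomial.aeval θ (X ^ n + C b * X + C b : ℤ[X]) = 0 →
        Algebra.adjoin ℚ ({(θ : K)} : Set K) = ⊤ →
        Algebra.adjoin ℤ ({θ} : Set (NumberField.RingOfIntegers K)) = ⊤) ∧
    {b : ℤ | Squarefree b ∧ Squarefree ((n : ℤ) ^ n + (1 - (n : ℤ)) ^ (n - 1) * b) ∧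
      b ≠ 0 ∧ b ≠ 1 ∧ b ≠ -1}.Infinite := by
  refine ⟨fun b hb hD hb0 hb1 hb2 => ⟨?_, ?_⟩, ?_⟩
  · exact ((s16_monic n hn b).irreducible_iff_irreducible_map_fraction_map (K := ℚ)).1
      (s16_irred n hn b hb hb1 hb2)
  · intro K _ _ θ hθ htop
    exact s16_main n hn b hb hD hb0 hb1 hb2 K θ hθ htop
  · refine s16_infinite _ _ (IsCoprime.pow ?_)
    exact ⟨1, 1, by ring⟩
end

section
/- The natural density of integers b such that both b and n^n + (1−n)^{n−1} b are square-free is at least (6/π²) − (1 − (6/π²)·∏_{p | n−1}(1 − 1/p²)^{−1}), which exceeds 12/π² − 1 ≈ 0.2158, for any fixed n > 2. -/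
open Real Filter

noncomputable def sfInd (a k : ℤ) (m b : ℕ) : ℝ := if (m : ℤ) ∣ a + k * (b : ℤ) then 1 else 0

lemma sfInd_count (a k : ℤ) (m : ℕ) (hm : 0 < m) (h : IsCoprime (m : ℤ) k) (x : ℕ) :
    |∑ b ∈ Finset.Ioc 0 x, sfInd a k m b - (x : ℝ) / m| ≤ 1 := by
  obtain ⟨u, v, huv⟩ := h
  have hmZ : (m : ℤ) ≠ 0 := by exact_mod_cast hm.ne'
  set r : ℕ := ((-v * a) % (m : ℤ)).toNat with hr
  have hr' : (r : ℤ) = (-v * a) % (m : ℤ) := Int.toNat_of_nonneg (Int.emod_nonneg _ hmZ)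
  have key : ∀ b : ℕ, ((m : ℤ) ∣ a + k * (b : ℤ)) ↔ b ≡ r [MOD m] := by
    intro b
    rw [← Int.natCast_modEq_iff, hr']
    have h1 : ((b : ℤ) ≡ (-v * a) % (m : ℤ) [ZMOD m]) ↔ ((b : ℤ) ≡ (-v * a) [ZMOD m]) :=
      ⟨fun h => h.trans (Int.mod_modEq _ _), fun h => h.trans (Int.mod_modEq _ _).symm⟩
    rw [h1, Int.modEq_comm, Int.modEq_iff_dvd]
    constructor
    · rintro ⟨c, hc⟩
      refine ⟨v * c + u * b, ?_⟩
      linear_combination v * hc - b * huv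
    · rintro ⟨c, hc⟩
      refine ⟨k * c + u * a, ?_⟩
      linear_combination k * hc - a * huv
  have hs : ∑ b ∈ Finset.Ioc 0 x, sfInd a k m b
      = ((Finset.Ioc 0 x).filter (fun b => b ≡ r [MOD m])).card := by
    simp only [sfInd, key]
    rw [Finset.sum_boole]
  have hc := Nat.Ioc_filter_modEq_card 0 x hm r
  have hmq : (0 : ℚ) < m := by exact_mod_cast hm
  have hle : ((0 : ℕ) - (r : ℚ)) / m ≤ ((x : ℚ) - r) / m := by
    gcongr
    simp
  rw [max_eq_left (sub_nonneg.2 (Int.floor_mono hle))] at hc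
  have f1 := Int.floor_le (((x : ℚ) - r) / m)
  have f2 := Int.lt_floor_add_one (((x : ℚ) - r) / m)
  have f3 := Int.floor_le (((0 : ℕ) - (r : ℚ)) / m)
  have f4 := Int.lt_floor_add_one (((0 : ℕ) - (r : ℚ)) / m)
  have hc' : ((((Finset.Ioc 0 x).filter (fun b => b ≡ r [MOD m])).card : ℕ) : ℚ)
      = (⌊((x : ℚ) - r) / m⌋ : ℚ) - (⌊((0 : ℕ) - (r : ℚ)) / m⌋ : ℚ) := by
    exact_mod_cast hc
  have e : ((x : ℚ) - r) / m - ((0 : ℕ) - (r : ℚ)) / m = x / m := by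
    push_cast; ring
  have hq : |((((Finset.Ioc 0 x).filter (fun b => b ≡ r [MOD m])).card : ℕ) : ℚ) - (x : ℚ) / m| ≤ 1 := by
    rw [hc', abs_le]
    constructor <;> linarith
  rw [hs]
  have hq' := (Rat.cast_le (K := ℝ)).2 hq
  push_cast at hq'
  exact hq'

lemma sfInd_tendsto (a k : ℤ) (m : ℕ) (hm : 0 < m) (h : IsCoprime (m : ℤ) k) :
    Tendsto (fun x : ℕ => (∑ b ∈ Finset.Ioc 0 x, sfInd a k m b) / (x : ℝ)) atTop
      (nhds (1 / (m : ℝ))) := by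
  rw [tendsto_iff_norm_sub_tendsto_zero]
  refine squeeze_zero' (Eventually.of_forall fun _ => norm_nonneg _) ?_
    (tendsto_one_div_atTop_nhds_zero_nat (𝕜 := ℝ))
  filter_upwards [eventually_gt_atTop 0] with x hx
  have hx' : (0 : ℝ) < x := by exact_mod_cast hx
  have := sfInd_count a k m hm h x
  have e : (∑ b ∈ Finset.Ioc 0 x, sfInd a k m b) / (x : ℝ) - 1 / m
      = (∑ b ∈ Finset.Ioc 0 x, sfInd a k m b - (x : ℝ) / m) / x := by
    field_simp
  rw [e, norm_div, Real.norm_eq_abs, Real.norm_eq_abs, abs_of_pos hx']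
  gcongr

lemma sfInd_prod (a k : ℤ) (T : Finset ℕ) (hT : ∀ p ∈ T, p.Prime) (b : ℕ) :
    ∏ p ∈ T, sfInd a k (p ^ 2) b = sfInd a k (∏ p ∈ T, p ^ 2) b := by
  have key : ((∏ p ∈ T, p ^ 2 : ℕ) : ℤ) ∣ a + k * (b : ℤ) ↔
      ∀ p ∈ T, ((p ^ 2 : ℕ) : ℤ) ∣ a + k * (b : ℤ) := by
    constructor
    · intro h p hp
      exact dvd_trans (by exact_mod_cast Finset.dvd_prod_of_mem (fun p => p ^ 2) hp) h
    · intro h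
      push_cast
      refine Finset.prod_dvd_of_coprime ?_ (fun p hp => by exact_mod_cast h p hp)
      intro p hp q hq hpq
      have : Nat.Coprime (p ^ 2) (q ^ 2) :=
        Nat.Coprime.pow _ _ ((Nat.coprime_primes (hT p hp) (hT q hq)).2 hpq)
      have := Nat.isCoprime_iff_coprime.2 this
      simpa [Function.onFun] using this
  unfold sfInd
  by_cases h : ∀ p ∈ T, ((p ^ 2 : ℕ) : ℤ) ∣ a + k * (b : ℤ)
  · rw [if_pos (key.2 h)]
    exact Finset.prod_eq_one fun p hp => if_pos (h p hp)
  · rw [if_neg (fun h' => h (key.1 h'))]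
    push Not at h
    obtain ⟨p, hp, h⟩ := h
    exact Finset.prod_eq_zero hp (if_neg h)

lemma sf_sieve_tendsto (a k : ℤ) (S : Finset ℕ) (hS : ∀ p ∈ S, p.Prime)
    (hk : ∀ p ∈ S, ¬ (p : ℤ) ∣ k) :
    Tendsto (fun x : ℕ => (∑ b ∈ Finset.Ioc 0 x, ∏ p ∈ S, (1 - sfInd a k (p ^ 2) b)) / (x : ℝ))
      atTop (nhds (∏ p ∈ S, (1 - 1 / (p : ℝ) ^ 2))) := by
  have e1 : ∏ p ∈ S, (1 - 1 / (p : ℝ) ^ 2)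
      = ∑ T ∈ S.powerset, (-1) ^ T.card * (1 / ((∏ p ∈ T, p ^ 2 : ℕ) : ℝ)) := by
    rw [Finset.prod_sub]
    refine Finset.sum_congr rfl fun T _ => ?_
    simp
  have e2 : ∀ x : ℕ, (∑ b ∈ Finset.Ioc 0 x, ∏ p ∈ S, (1 - sfInd a k (p ^ 2) b)) / (x : ℝ)
      = ∑ T ∈ S.powerset, (-1) ^ T.card *
        ((∑ b ∈ Finset.Ioc 0 x, sfInd a k (∏ p ∈ T, p ^ 2) b) / (x : ℝ)) := by
    intro x
    simp_rw [Finset.prod_sub]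
    rw [Finset.sum_comm, Finset.sum_div]
    refine Finset.sum_congr rfl fun T hT => ?_
    rw [Finset.mem_powerset] at hT
    simp_rw [sfInd_prod a k T (fun p hp => hS p (hT hp))]
    simp [← Finset.mul_sum, mul_div_assoc]
  simp_rw [e2]
  rw [e1]
  refine tendsto_finsetSum _ fun T hT => ?_
  rw [Finset.mem_powerset] at hT
  refine (sfInd_tendsto a k _ ?_ ?_).const_mul _
  · exact Finset.prod_pos fun p hp => pow_pos (hS p (hT hp)).pos _
  · push_cast
    refine IsCoprime.prod_left fun p hp => IsCoprime.pow_left ?_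
    exact (Prime.coprime_iff_not_dvd (Nat.prime_iff_prime_int.1 (hS p (hT hp)))).2 (hk p (hT hp))

lemma euler_real : Tendsto (fun z : ℕ => ∏ p ∈ Nat.primesBelow z, (1 - 1 / (p : ℝ) ^ 2)) atTop
    (nhds (6 / π ^ 2)) := by
  have h := riemannZeta_eulerProduct (s := 2) (by norm_num)
  rw [riemannZeta_two] at h
  have h2 := h.inv₀ (by simp [Real.pi_ne_zero])
  have h3 := (Complex.continuous_re.tendsto _).comp h2
  have e : ((π : ℂ) ^ 2 / 6)⁻¹.re = 6 / π ^ 2 := by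
    have : ((π : ℂ) ^ 2 / 6)⁻¹ = ((6 / π ^ 2 : ℝ) : ℂ) := by push_cast; rw [inv_div]
    rw [this, Complex.ofReal_re]
  rw [e] at h3
  refine h3.congr fun z => ?_
  have : (∏ p ∈ Nat.primesBelow z, (1 - (p : ℂ) ^ (-2 : ℂ))⁻¹)⁻¹
      = ((∏ p ∈ Nat.primesBelow z, (1 - 1 / (p : ℝ) ^ 2) : ℝ) : ℂ) := by
    push_cast
    rw [← Finset.prod_inv_distrib]
    refine Finset.prod_congr rfl fun p _ => ?_
    rw [inv_inv, Complex.cpow_neg]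
    norm_cast
    simp
  simp only [Function.comp]
  rw [this, Complex.ofReal_re]

lemma one_sub_pos_of_prime {p : ℕ} (hp : p.Prime) : 0 < 1 - 1 / (p : ℝ) ^ 2 := by
  have : (2 : ℝ) ≤ p := by exact_mod_cast hp.two_le
  rw [sub_pos, div_lt_one (by positivity)]
  nlinarith

lemma euler_real' (k : ℕ) (hk : k ≠ 0) :
    Tendsto (fun z : ℕ => ∏ p ∈ (Nat.primesBelow z).filter (fun p => ¬ p ∣ k), (1 - 1 / (p : ℝ) ^ 2))
      atTop (nhds (6 / π ^ 2 * ∏ p ∈ k.primeFactors, ((1 : ℝ) - 1 / (p : ℝ) ^ 2)⁻¹)) := by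
  refine (euler_real.mul_const _).congr' ?_
  filter_upwards [eventually_gt_atTop k] with z hz
  rw [← Finset.prod_filter_mul_prod_filter_not (Nat.primesBelow z) (fun p => p ∣ k)]
  have e : (Nat.primesBelow z).filter (fun p => p ∣ k) = k.primeFactors := by
    ext p
    simp only [Finset.mem_filter, Nat.mem_primesBelow, Nat.mem_primeFactors]
    constructor
    · rintro ⟨⟨_, h⟩, h'⟩; exact ⟨h, h', hk⟩
    · rintro ⟨h, h', _⟩
      exact ⟨⟨(Nat.le_of_dvd (Nat.pos_of_ne_zero hk) h').trans_lt hz, h⟩, h'⟩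
  rw [e, Finset.prod_inv_distrib]
  have : ∏ p ∈ k.primeFactors, ((1 : ℝ) - 1 / (p : ℝ) ^ 2) ≠ 0 :=
    Finset.prod_ne_zero_iff.2 fun p hp =>
      (one_sub_pos_of_prime (Nat.prime_of_mem_primeFactors hp)).ne'
  field_simp

lemma sfInd_nonneg (a k : ℤ) (m b : ℕ) : 0 ≤ sfInd a k m b := by
  unfold sfInd; split_ifs <;> norm_num

lemma sfInd_le_one (a k : ℤ) (m b : ℕ) : sfInd a k m b ≤ 1 := by
  unfold sfInd; split_ifs <;> norm_num

open Classical in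
lemma sf_pointwise (a k : ℤ) (hc : IsCoprime a k) (z D b : ℕ)
    (hne : a + k * (b : ℤ) ≠ 0) (hD : (a + k * (b : ℤ)).natAbs < D ^ 2) :
    ∏ p ∈ (Nat.primesBelow z).filter (fun p => ¬ p ∣ k.natAbs), (1 - sfInd a k (p ^ 2) b)
      - ∑ p ∈ (Finset.Ico z D).filter (fun p => p.Prime ∧ ¬ p ∣ k.natAbs), sfInd a k (p ^ 2) b
      ≤ if Squarefree (a + k * (b : ℤ)) then (1 : ℝ) else 0 := by
  have hprod1 : ∏ p ∈ (Nat.primesBelow z).filter (fun p => ¬ p ∣ k.natAbs),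
      (1 - sfInd a k (p ^ 2) b) ≤ 1 :=
    Finset.prod_le_one (fun p _ => by linarith [sfInd_le_one a k (p ^ 2) b])
      (fun p _ => by linarith [sfInd_nonneg a k (p ^ 2) b])
  have hsum0 : 0 ≤ ∑ p ∈ (Finset.Ico z D).filter (fun p => p.Prime ∧ ¬ p ∣ k.natAbs),
      sfInd a k (p ^ 2) b := Finset.sum_nonneg fun p _ => sfInd_nonneg _ _ _ _
  split_ifs with hsf
  · linarith
  · rw [← Int.squarefree_natAbs, Nat.squarefree_iff_prime_squarefree] at hsf
    push Not at hsf
    obtain ⟨p, hp, hpd⟩ := hsf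
    have hpd' : ((p ^ 2 : ℕ) : ℤ) ∣ a + k * (b : ℤ) := by
      rw [Int.natCast_dvd, pow_two]; exact hpd
    have hone : sfInd a k (p ^ 2) b = 1 := if_pos hpd'
    have hpk : ¬ p ∣ k.natAbs := by
      intro h
      have h1 : (p : ℤ) ∣ k := Int.natCast_dvd.2 h
      have h2 : (p : ℤ) ∣ a + k * (b : ℤ) := dvd_trans (by push_cast; exact dvd_pow_self _ (by norm_num)) hpd'
      have h3 : (p : ℤ) ∣ a := (Int.dvd_add_left (h1.mul_right _)).1 h2
      have := hc.isUnit_of_dvd' h3 h1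
      exact (Nat.prime_iff_prime_int.1 hp).not_isUnit this
    have hpD : p < D := by
      have : p * p ≤ (a + k * (b : ℤ)).natAbs :=
        Nat.le_of_dvd (Int.natAbs_pos.2 hne) hpd
      nlinarith
    rcases lt_or_ge p z with hz | hz
    · rw [Finset.prod_eq_zero (i := p)]
      · linarith
      · simp [Nat.mem_primesBelow, hz, hp, hpk]
      · rw [hone]; norm_num
    · have := Finset.single_le_sum (f := fun p => sfInd a k (p ^ 2) b)
        (s := (Finset.Ico z D).filter (fun p => p.Prime ∧ ¬ p ∣ k.natAbs))
        (fun p _ => sfInd_nonneg a k (p ^ 2) b) (a := p) (by simp [hz, hpD, hp, hpk])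
      simp only [hone] at this
      linarith

open Classical in
lemma sf_lower (a k : ℤ) (hk : k ≠ 0) (hc : IsCoprime a k)
    (hne : ∀ b : ℕ, 1 ≤ b → a + k * (b : ℤ) ≠ 0) (ε : ℝ) (hε : 0 < ε) :
    ∀ᶠ x : ℕ in atTop,
      6 / π ^ 2 * ∏ p ∈ k.natAbs.primeFactors, ((1 : ℝ) - 1 / (p : ℝ) ^ 2)⁻¹ - ε ≤
      (∑ b ∈ Finset.Ioc 0 x, if Squarefree (a + k * (b : ℤ)) then (1 : ℝ) else 0) / x := by
  set c := 6 / π ^ 2 * ∏ p ∈ k.natAbs.primeFactors, ((1 : ℝ) - 1 / (p : ℝ) ^ 2)⁻¹ with hcdef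
  have hz1 := (euler_real' k.natAbs (Int.natAbs_ne_zero.2 hk)).eventually_const_lt
    (show c - ε / 4 < c by linarith)
  have hz2 : ∀ᶠ z : ℕ in atTop, (2 : ℝ) / z < ε / 4 :=
    (tendsto_const_div_atTop_nhds_zero_nat (2 : ℝ)).eventually_lt_const (by linarith)
  obtain ⟨z, ⟨hz1, hz2⟩, hz3⟩ := ((hz1.and hz2).and (eventually_ge_atTop 1)).exists
  set S := (Nat.primesBelow z).filter (fun p => ¬ p ∣ k.natAbs) with hS
  have hx1 := (sf_sieve_tendsto a k S
    (fun p hp => (Nat.mem_primesBelow.1 (Finset.mem_filter.1 hp).1).2)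
    (fun p hp h => (Finset.mem_filter.1 hp).2 (Int.natCast_dvd.1 h))).eventually_const_lt hz1
  set A := a.natAbs + k.natAbs with hA
  have hA0 : 0 < A := by have := Int.natAbs_pos.2 hk; omega
  -- the error term
  have hx2 : ∀ᶠ x : ℕ in atTop, ((Nat.sqrt (A * x) + 1 : ℕ) : ℝ) ≤ ε / 4 * x := by
    have h1 : ∀ᶠ x : ℕ in atTop, (A : ℝ) * (8 / ε) ^ 2 + 8 / ε < x :=
      tendsto_natCast_atTop_atTop.eventually_gt_atTop _
    filter_upwards [h1] with x hx
    have hs : ((Nat.sqrt (A * x) : ℕ) : ℝ) ^ 2 ≤ A * x := by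
      exact_mod_cast Nat.sqrt_le' (A * x)
    have hx0 : 0 ≤ (A : ℝ) * (8 / ε) ^ 2 := by positivity
    have hx00 : 0 < 8 / ε := by positivity
    have hb : (1 : ℝ) ≤ ε / 8 * x := by
      have : 8 / ε ≤ x := by linarith
      rw [div_le_iff₀ hε] at this
      linarith
    have hAx : (A : ℝ) * x ≤ (ε / 8 * x) ^ 2 := by
      have h : (A : ℝ) * (8 / ε) ^ 2 ≤ x := by linarith
      have h' : (A : ℝ) ≤ (ε / 8) ^ 2 * x := by
        have := mul_le_mul_of_nonneg_right h (sq_nonneg (ε / 8))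
        have e : (A : ℝ) * (8 / ε) ^ 2 * (ε / 8) ^ 2 = A := by field_simp
        linarith
      have := mul_le_mul_of_nonneg_right h' (Nat.cast_nonneg (α := ℝ) x)
      calc (A : ℝ) * x ≤ _ := this
        _ = _ := by ring
    have := abs_le_of_sq_le_sq' (hs.trans hAx) (by linarith)
    push_cast
    linarith [this.2]
  filter_upwards [hx1, hx2, eventually_gt_atTop 0] with x hx1 hx2 hx0
  have hxp : (0 : ℝ) < x := by exact_mod_cast hx0
  set D := Nat.sqrt (A * x) + 1 with hDdef
  set R := (Finset.Ico z D).filter (fun p => p.Prime ∧ ¬ p ∣ k.natAbs) with hR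
  have hpt : ∑ b ∈ Finset.Ioc 0 x, (∏ p ∈ S, (1 - sfInd a k (p ^ 2) b)
      - ∑ p ∈ R, sfInd a k (p ^ 2) b) ≤
      ∑ b ∈ Finset.Ioc 0 x, if Squarefree (a + k * (b : ℤ)) then (1 : ℝ) else 0 := by
    refine Finset.sum_le_sum fun b hb => ?_
    rw [Finset.mem_Ioc] at hb
    refine sf_pointwise a k hc z D b (hne b hb.1) ?_
    have h1 : (a + k * (b : ℤ)).natAbs ≤ A * x := by
      refine (Int.natAbs_add_le _ _).trans ?_
      rw [Int.natAbs_mul, Int.natAbs_natCast, hA, add_mul]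
      have : a.natAbs ≤ a.natAbs * x := Nat.le_mul_of_pos_right _ hx0
      have : k.natAbs * b ≤ k.natAbs * x := Nat.mul_le_mul_left _ hb.2
      omega
    exact h1.trans_lt (Nat.lt_succ_sqrt' (A * x))
  rw [Finset.sum_sub_distrib, Finset.sum_comm (s := Finset.Ioc 0 x) (t := R)] at hpt
  have htail : ∑ p ∈ R, ∑ b ∈ Finset.Ioc 0 x, sfInd a k (p ^ 2) b ≤ x * (2 / z) + D := by
    have h1 : ∀ p ∈ R, ∑ b ∈ Finset.Ioc 0 x, sfInd a k (p ^ 2) b ≤ x * ((p : ℝ) ^ 2)⁻¹ + 1 := by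
      intro p hp
      have hp' := (Finset.mem_filter.1 hp).2
      have := sfInd_count a k (p ^ 2) (pow_pos hp'.1.pos _) (by
        push_cast
        refine IsCoprime.pow_left ?_
        exact (Prime.coprime_iff_not_dvd (Nat.prime_iff_prime_int.1 hp'.1)).2
          (fun h => hp'.2 (Int.natCast_dvd.1 h))) x
      have := (abs_le.1 this).2
      push_cast at this
      rw [div_eq_mul_inv] at this
      linarith
    have hsub : R ⊆ Finset.Ioo (z - 1) D := by
      intro p hp
      have := Finset.mem_Ico.1 (Finset.mem_filter.1 hp).1
      rw [Finset.mem_Ioo]; omega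
    have hcard : (R.card : ℝ) ≤ D := by
      have : R.card ≤ (Finset.Ico z D).card := Finset.card_filter_le _ _
      rw [Nat.card_Ico] at this
      exact_mod_cast this.trans (Nat.sub_le _ _)
    have hsq : ∑ p ∈ R, ((p : ℝ) ^ 2)⁻¹ ≤ 2 / z := by
      refine (Finset.sum_le_sum_of_subset_of_nonneg hsub fun p _ _ => by positivity).trans ?_
      have := sum_Ioo_inv_sq_le (α := ℝ) (z - 1) D
      rw [Nat.cast_sub hz3] at this
      simpa using this
    calc _ ≤ ∑ p ∈ R, ((x : ℝ) * ((p : ℝ) ^ 2)⁻¹ + 1) := Finset.sum_le_sum h1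
      _ = x * ∑ p ∈ R, ((p : ℝ) ^ 2)⁻¹ + R.card := by
        rw [Finset.sum_add_distrib, Finset.mul_sum]; simp
      _ ≤ _ := by gcongr
  rw [le_div_iff₀ hxp]
  rw [lt_div_iff₀ hxp] at hx1
  have : (x : ℝ) * (2 / z) ≤ x * (ε / 4) := by gcongr
  nlinarith

theorem stmt17 (n : ℕ) (hn : 2 < n) :
    (6 / π ^ 2 - (1 - 6 / π ^ 2 * ∏ p ∈ (n - 1).primeFactors, ((1 : ℝ) - 1 / (p : ℝ) ^ 2)⁻¹)
        > 12 / π ^ 2 - 1) ∧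
    Filter.atTop.liminf (fun x : ℕ =>
        (Nat.card {b : ℕ // b ∈ Finset.Icc 1 x ∧ Squarefree b ∧
          Squarefree ((n : ℤ) ^ n + (1 - (n : ℤ)) ^ (n - 1) * (b : ℤ))} : ℝ) / x) ≥
      6 / π ^ 2 - (1 - 6 / π ^ 2 * ∏ p ∈ (n - 1).primeFactors, ((1 : ℝ) - 1 / (p : ℝ) ^ 2)⁻¹) := by
  classical
  constructor
  · have h1 : 1 < ∏ p ∈ (n - 1).primeFactors, ((1 : ℝ) - 1 / (p : ℝ) ^ 2)⁻¹ := by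
      have hlt : ∀ p ∈ (n - 1).primeFactors, 1 < ((1 : ℝ) - 1 / (p : ℝ) ^ 2)⁻¹ := by
        intro p hp
        have hp := Nat.prime_of_mem_primeFactors hp
        have : (0 : ℝ) < p := by exact_mod_cast hp.pos
        refine (one_lt_inv₀ (one_sub_pos_of_prime hp)).2 ?_
        have : (0 : ℝ) < 1 / (p : ℝ) ^ 2 := by positivity
        linarith
      have hne : (n - 1).primeFactors.Nonempty := Nat.nonempty_primeFactors.2 (by omega)
      have := Finset.prod_lt_prod_of_nonempty (f := fun _ => (1 : ℝ))
        (fun p _ => one_pos) hlt hne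
      simpa using this
    have h2 : 0 < 6 / π ^ 2 := by positivity
    have h3 : 12 / π ^ 2 = 6 / π ^ 2 + 6 / π ^ 2 := by ring
    rw [h3]
    nlinarith
  · set a : ℤ := (n : ℤ) ^ n with ha
    set k : ℤ := (1 - (n : ℤ)) ^ (n - 1) with hkdef
    have hn1 : (1 - (n : ℤ)).natAbs = n - 1 := by omega
    have hk : k ≠ 0 := pow_ne_zero _ (by omega)
    have hc : IsCoprime a k := by
      refine IsCoprime.pow ⟨1, 1, by ring⟩
    have hne : ∀ b : ℕ, 1 ≤ b → a + k * (b : ℤ) ≠ 0 := by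
      intro b _ h
      have h1 : k ∣ a := ⟨-b, by linear_combination h⟩
      have h2 : IsUnit k := hc.isUnit_of_dvd' h1 dvd_rfl
      have h3 := (isUnit_pow_iff (by omega : n - 1 ≠ 0)).1 h2
      rw [Int.isUnit_iff_natAbs_eq, hn1] at h3
      omega
    have hpf : k.natAbs.primeFactors = (n - 1).primeFactors := by
      rw [hkdef, Int.natAbs_pow, hn1, Nat.primeFactors_pow _ (by omega)]
    set C := 6 / π ^ 2 * ∏ p ∈ (n - 1).primeFactors, ((1 : ℝ) - 1 / (p : ℝ) ^ 2)⁻¹ with hC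
    have hcard : ∀ x : ℕ, (Nat.card {b : ℕ // b ∈ Finset.Icc 1 x ∧ Squarefree b ∧
          Squarefree (a + k * (b : ℤ))} : ℝ)
        = ∑ b ∈ Finset.Ioc 0 x, if Squarefree b ∧ Squarefree (a + k * (b : ℤ)) then (1 : ℝ) else 0 := by
      intro x
      rw [Finset.sum_boole, Nat.subtype_card]
      intro b
      simp only [Finset.mem_filter, Finset.mem_Ioc, Finset.mem_Icc]
      rfl
    simp_rw [hcard]
    have hle1 : ∀ x : ℕ, (∑ b ∈ Finset.Ioc 0 x, if Squarefree b ∧ Squarefree (a + k * (b : ℤ))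
        then (1 : ℝ) else 0) / x ≤ 1 := by
      intro x
      refine div_le_one_of_le₀ ?_ (Nat.cast_nonneg _)
      refine (Finset.sum_le_sum (g := fun _ => (1 : ℝ)) fun b _ => ?_).trans (by simp)
      split_ifs <;> norm_num
    refine le_of_forall_pos_sub_le fun ε hε => ?_
    refine le_liminf_of_le ?_ ?_
    · exact (isBoundedUnder_of ⟨1, hle1⟩ :
        IsBoundedUnder (· ≤ ·) atTop _).isCoboundedUnder_ge
    · have h1 := sf_lower a k hk hc hne (ε / 2) (by linarith)
      have h2 := sf_lower 0 1 one_ne_zero isCoprime_one_right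
        (fun b hb => by simp; omega) (ε / 2) (by linarith)
      rw [hpf] at h1
      simp only [Int.natAbs_one, Nat.primeFactors_one, Finset.prod_empty, mul_one, zero_add,
        one_mul, Int.squarefree_natCast] at h2
      filter_upwards [h1, h2, eventually_gt_atTop 0] with x h1 h2 hx
      have hxp : (0 : ℝ) < x := by exact_mod_cast hx
      rw [le_div_iff₀ hxp] at h1 h2 ⊢
      have h3 : ∑ b ∈ Finset.Ioc 0 x, ((if Squarefree (a + k * (b : ℤ)) then (1 : ℝ) else 0)
          + (if Squarefree b then (1 : ℝ) else 0) - 1) ≤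
          ∑ b ∈ Finset.Ioc 0 x, if Squarefree b ∧ Squarefree (a + k * (b : ℤ))
            then (1 : ℝ) else 0 := by
        refine Finset.sum_le_sum fun b _ => ?_
        by_cases p : Squarefree b <;> by_cases q : Squarefree (a + k * (b : ℤ)) <;> simp [p, q]
      rw [Finset.sum_sub_distrib, Finset.sum_add_distrib] at h3
      simp only [Finset.sum_const, Nat.card_Ioc, nsmul_eq_mul, mul_one, Nat.sub_zero] at h3
      nlinarith
end

section
/- For coprime integers m, k with gcd(m,k) = 1, the number S(x; m, k) of square-free integers not exceeding x that are congruent to m modulo k satisfies S(x; m, k) ~ (6x)/(π² k) · ∏_{p | k} (1 − 1/p²)^{−1} as x → ∞ (for fixed k). -/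
open Real Filter

open ArithmeticFunction in
lemma aux_sqfree_sum (n N : ℕ) (hn : 0 < n) (hN : n ≤ N) :
    (∑ d ∈ (Finset.Ioc 0 N).filter (fun d => d ^ 2 ∣ n), (moebius d : ℤ)) =
      if Squarefree n then 1 else 0 := by
  obtain ⟨a, b, ha, hb, hab, hsq⟩ := Nat.sq_mul_squarefree_of_pos hn
  have key : ∀ d : ℕ, d ^ 2 ∣ n ↔ d ∣ b := by
    intro d
    constructor
    · intro h
      rw [← hab] at h
      have hd0 : 0 < d := by
        rcases Nat.eq_zero_or_pos d with h0 | h0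
        · subst h0
          simp at h
          omega
        · exact h0
      obtain ⟨g, d', b', hg, hcop, hd, hb'⟩ := Nat.exists_coprime' (m := d) (n := b)
        (Nat.gcd_pos_of_pos_left _ hd0)
      rw [hd, hb', mul_pow, mul_pow, mul_right_comm] at h
      have h1 : d' ^ 2 ∣ b' ^ 2 * a := Nat.dvd_of_mul_dvd_mul_right (by positivity) h
      have h2 : d' ^ 2 ∣ a := (Nat.Coprime.pow 2 2 hcop).dvd_of_dvd_mul_left h1
      have h3 := hsq d' (by rwa [← sq])
      rw [Nat.isUnit_iff] at h3
      rw [hd, hb', h3]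
      exact Nat.mul_dvd_mul_right (one_dvd _) _
    · intro h
      rw [← hab]
      exact (pow_dvd_pow_of_dvd h 2).mul_right a
  have hbn : b ≤ n := by
    rw [← hab]
    nlinarith
  have hset : (Finset.Ioc 0 N).filter (fun d => d ^ 2 ∣ n) = b.divisors := by
    ext d
    simp only [Finset.mem_filter, Finset.mem_Ioc, key, Nat.mem_divisors]
    constructor
    · rintro ⟨_, h⟩
      exact ⟨h, hb.ne'⟩
    · rintro ⟨h, _⟩
      exact ⟨⟨Nat.pos_of_dvd_of_pos h hb, (Nat.le_of_dvd hb h).trans (hbn.trans hN)⟩, h⟩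
  rw [hset]
  have hmz := congrArg (fun f : ArithmeticFunction ℤ => f b) moebius_mul_coe_zeta
  simp only [coe_mul_zeta_apply, one_apply] at hmz
  rw [hmz]
  have : Squarefree n ↔ b = 1 := by
    constructor
    · intro h
      have := h b (by rw [← hab, sq]; exact dvd_mul_right _ _)
      rwa [Nat.isUnit_iff] at this
    · intro h
      rw [← hab, h]
      simpa using hsq
  simp [this]

lemma aux_modEq_tendsto (r v : ℕ) (hr : 0 < r) :
    Tendsto (fun x : ℕ => (((Finset.Ioc 0 x).filter (fun n => n ≡ v [MOD r])).card : ℝ) / x)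
      atTop (nhds (1 / (r : ℝ))) := by
  have hb : ∀ x : ℕ, |(((Finset.Ioc 0 x).filter (fun n => n ≡ v [MOD r])).card : ℝ)
      - (x : ℝ) / r| ≤ 1 := by
    intro x
    have h := Nat.Ioc_filter_modEq_card 0 x hr v
    have hr' : (0 : ℚ) < r := by exact_mod_cast hr
    have hmono : ⌊(((0 : ℕ) : ℚ) - v) / (r : ℚ)⌋ ≤ ⌊((x : ℚ) - v) / (r : ℚ)⌋ := by
      gcongr
      exact Nat.zero_le x
    rw [max_eq_left (sub_nonneg.mpr hmono)] at h
    have hq : |(((Finset.Ioc 0 x).filter (fun n => n ≡ v [MOD r])).card : ℚ)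
      - (x : ℚ) / r| ≤ 1 := by
      have h' : (((Finset.Ioc 0 x).filter (fun n => n ≡ v [MOD r])).card : ℚ) =
        ⌊((x : ℚ) - v) / (r : ℚ)⌋ - ⌊(((0 : ℕ) : ℚ) - v) / (r : ℚ)⌋ := by exact_mod_cast h
      rw [h']
      have e : (x : ℚ) / r = ((x : ℚ) - v) / (r : ℚ) - (((0 : ℕ) : ℚ) - v) / (r : ℚ) := by
        push_cast; ring
      have a1 := Int.floor_le (((x : ℚ) - v) / (r : ℚ))
      have a2 := Int.lt_floor_add_one (((x : ℚ) - v) / (r : ℚ))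
      have a3 := Int.floor_le ((((0 : ℕ) : ℚ) - v) / (r : ℚ))
      have a4 := Int.lt_floor_add_one ((((0 : ℕ) : ℚ) - v) / (r : ℚ))
      rw [e, abs_le]
      constructor <;> linarith
    have hq2 := (Rat.cast_le (K := ℝ)).mpr hq
    push_cast at hq2
    exact hq2
  rw [tendsto_iff_norm_sub_tendsto_zero]
  refine squeeze_zero' (Eventually.of_forall fun _ => norm_nonneg _) ?_
    tendsto_one_div_atTop_nhds_zero_nat
  filter_upwards [eventually_gt_atTop 0] with x hx
  have hx' : (0 : ℝ) < x := by exact_mod_cast hx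
  have hr' : (0 : ℝ) < r := by exact_mod_cast hr
  have : (((Finset.Ioc 0 x).filter (fun n => n ≡ v [MOD r])).card : ℝ) / x - 1 / r =
      ((((Finset.Ioc 0 x).filter (fun n => n ≡ v [MOD r])).card : ℝ) - x / r) / x := by
    field_simp
  rw [this, Real.norm_eq_abs, abs_div, abs_of_pos hx']
  gcongr
  exact hb x

/-- The number of multiples of `d ^ 2` up to `x` in the given residue class. -/
def auxA (m k d x : ℕ) : ℕ :=
  ((Finset.Ioc 0 x).filter (fun n => d ^ 2 ∣ n ∧ n % k = m % k)).card

lemma auxA_le (m k d x : ℕ) : (auxA m k d x : ℝ) / x ≤ 1 / (d : ℝ) ^ 2 := by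
  have h1 : auxA m k d x ≤ x / d ^ 2 := by
    rw [← Nat.Ioc_filter_dvd_card_eq_div]
    apply Finset.card_le_card
    intro n
    simp only [Finset.mem_filter]
    tauto
  have h2 : (auxA m k d x : ℝ) ≤ (x : ℝ) / (d : ℝ) ^ 2 := by
    refine (Nat.cast_le.mpr h1).trans ?_
    have := @Nat.cast_div_le ℝ _ _ _ x (d ^ 2)
    simpa using this
  rcases Nat.eq_zero_or_pos x with rfl | hx
  · simp
  · have hx' : (0 : ℝ) < x := by exact_mod_cast hx
    rw [div_le_iff₀ hx']
    refine h2.trans (le_of_eq ?_)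
    ring

lemma auxA_not_coprime (m k d x : ℕ) (hcop : Nat.Coprime m k) (hd : ¬ Nat.Coprime d k) :
    auxA m k d x = 0 := by
  unfold auxA
  rw [Finset.card_eq_zero, Finset.filter_eq_empty_iff]
  rintro n - ⟨h1, h2⟩
  apply hd
  have hn : Nat.Coprime n k := by
    have : n ≡ m [MOD k] := h2
    unfold Nat.Coprime at *
    rw [this.gcd_eq, hcop]
  exact Nat.Coprime.coprime_dvd_left ((dvd_pow_self d two_ne_zero).trans h1) hn

lemma auxA_tendsto (m k d : ℕ) (hk : 0 < k) (hd0 : 0 < d) (hd : Nat.Coprime d k) :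
    Tendsto (fun x : ℕ => (auxA m k d x : ℝ) / x) atTop
      (nhds (1 / ((d : ℝ) ^ 2 * k))) := by
  have hc : Nat.Coprime (d ^ 2) k := Nat.Coprime.pow_left 2 hd
  obtain ⟨v, hv1, hv2⟩ := Nat.chineseRemainder hc 0 m
  have h := aux_modEq_tendsto (d ^ 2 * k) v (by positivity)
  push_cast at h
  refine h.congr fun x => ?_
  unfold auxA
  congr 3
  ext n
  simp only [Finset.mem_filter, and_congr_right_iff]
  intro _
  rw [← Nat.modEq_and_modEq_iff_modEq_mul hc]
  constructor
  · rintro ⟨a, b⟩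
    exact ⟨(Nat.modEq_zero_iff_dvd).mp (a.trans hv1), b.trans hv2⟩
  · rintro ⟨a, b⟩
    exact ⟨((Nat.modEq_zero_iff_dvd).mpr a).trans hv1.symm, Nat.ModEq.trans b hv2.symm⟩

open ArithmeticFunction in
/-- Counting formula. -/
lemma aux_count (m k x : ℕ) :
    (Nat.card {r : ℕ // r ∈ Finset.Icc 1 x ∧ Squarefree r ∧ r % k = m % k} : ℝ) =
      ∑' d : ℕ, (moebius d : ℝ) * auxA m k d x := by
  rw [tsum_eq_sum (s := Finset.Ioc 0 x)]
  · have h1 : Nat.card {r : ℕ // r ∈ Finset.Icc 1 x ∧ Squarefree r ∧ r % k = m % k} =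
        (((Finset.Ioc 0 x).filter (fun n => n % k = m % k)).filter
          (fun n => Squarefree n)).card := by
      apply Nat.subtype_card
      intro n
      simp only [Finset.mem_filter, Finset.mem_Ioc, Finset.mem_Icc, Nat.succ_le_iff]
      tauto
    have h2 : ((((Finset.Ioc 0 x).filter (fun n => n % k = m % k)).filter
          (fun n => Squarefree n)).card : ℤ) =
        ∑ d ∈ Finset.Ioc 0 x, moebius d * (auxA m k d x : ℤ) := by
      rw [Finset.card_filter]
      push_cast
      have : ∀ n ∈ (Finset.Ioc 0 x).filter (fun n => n % k = m % k),
          (if Squarefree n then (1 : ℤ) else 0) =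
          ∑ d ∈ Finset.Ioc 0 x, if d ^ 2 ∣ n then moebius d else 0 := by
        intro n hn
        simp only [Finset.mem_filter, Finset.mem_Ioc] at hn
        rw [← aux_sqfree_sum n x hn.1.1 hn.1.2, Finset.sum_filter]
      rw [Finset.sum_congr rfl this, Finset.sum_comm]
      refine Finset.sum_congr rfl fun d _ => ?_
      rw [← Finset.sum_filter, Finset.sum_const, Finset.filter_filter]
      unfold auxA
      simp only [nsmul_eq_mul]
      rw [mul_comm]
      congr 4
      ext n
      tauto
    rw [h1]
    exact_mod_cast h2
  · intro d hd
    rcases Nat.eq_zero_or_pos d with rfl | h0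
    · simp
    · have : auxA m k d x = 0 := by
        unfold auxA
        rw [Finset.card_eq_zero, Finset.filter_eq_empty_iff]
        rintro n hn ⟨h1, -⟩
        simp only [Finset.mem_Ioc] at hn hd
        have := Nat.le_of_dvd hn.1 h1
        have : d ≤ d ^ 2 := by nlinarith
        omega
      simp [this]

open ArithmeticFunction in
lemma aux_value (k : ℕ) (hk : 0 < k) :
    ∑' d : ℕ, (if Nat.Coprime d k then (moebius d : ℝ) / (d : ℝ) ^ 2 else 0) =
      6 / π ^ 2 * ∏ p ∈ k.primeFactors, ((1 : ℝ) - 1 / (p : ℝ) ^ 2)⁻¹ := by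
  have : NeZero k := ⟨hk.ne'⟩
  have h2 : 1 < (2 : ℂ).re := by norm_num
  have h := DirichletCharacter.LSeries.mul_mu_eq_one (1 : DirichletCharacter ℂ k) h2
  rw [← DirichletCharacter.LFunction_eq_LSeries _ h2] at h
  have ht := DirichletCharacter.LFunctionTrivChar_eq_mul_riemannZeta (N := k) (s := 2)
    (by norm_num)
  unfold DirichletCharacter.LFunctionTrivChar at ht
  rw [ht, riemannZeta_two] at h
  have hL : LSeries ((fun n : ℕ => (1 : DirichletCharacter ℂ k) n) *
      (fun n : ℕ => ((moebius n : ℤ) : ℂ))) 2 =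
      ((∑' d : ℕ, (if Nat.Coprime d k then (moebius d : ℝ) / (d : ℝ) ^ 2 else 0) : ℝ) : ℂ) := by
    rw [LSeries, Complex.ofReal_tsum]
    refine tsum_congr fun d => ?_
    rcases Nat.eq_zero_or_pos d with rfl | h0
    · simp
    · rw [LSeries.term_of_ne_zero h0.ne']
      by_cases hc : Nat.Coprime d k
      · have hu : IsUnit (d : ZMod k) := (ZMod.isUnit_iff_coprime d k).mpr hc
        rw [if_pos hc]
        simp [MulChar.one_apply hu]
      · have hu : ¬ IsUnit (d : ZMod k) := fun h => hc ((ZMod.isUnit_iff_coprime d k).mp h)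
        simp [hc, MulChar.map_nonunit _ hu]
  rw [hL] at h
  have hP : (∏ p ∈ k.primeFactors, (1 - (p : ℂ) ^ (-2 : ℂ))) =
      ((∏ p ∈ k.primeFactors, ((1 : ℝ) - 1 / (p : ℝ) ^ 2) : ℝ) : ℂ) := by
    push_cast
    refine Finset.prod_congr rfl fun p _ => ?_
    rw [Complex.cpow_neg]
    simp
  rw [hP] at h
  have hR : (∏ p ∈ k.primeFactors, ((1 : ℝ) - 1 / (p : ℝ) ^ 2)) * (π ^ 2 / 6) *
    (∑' d : ℕ, (if Nat.Coprime d k then (moebius d : ℝ) / (d : ℝ) ^ 2 else 0)) = 1 := by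
    exact_mod_cast h
  rw [Finset.prod_inv_distrib]
  rw [eq_inv_of_mul_eq_one_right hR]
  rw [mul_inv, inv_div, mul_comm]

open ArithmeticFunction in
theorem aux_main (m k : ℕ) (hk : 0 < k) (hcop : Nat.Coprime m k) :
    Tendsto (fun x : ℕ =>
        (Nat.card {r : ℕ // r ∈ Finset.Icc 1 x ∧ Squarefree r ∧ r % k = m % k} : ℝ) / x)
      atTop (nhds ((6 / π ^ 2 * ∏ p ∈ k.primeFactors, ((1 : ℝ) - 1 / (p : ℝ) ^ 2)⁻¹) / k)) := by
  rw [← aux_value k hk, ← tsum_div_const]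
  have e : ∀ x : ℕ,
      (Nat.card {r : ℕ // r ∈ Finset.Icc 1 x ∧ Squarefree r ∧ r % k = m % k} : ℝ) / x =
      ∑' d : ℕ, (moebius d : ℝ) * ((auxA m k d x : ℝ) / x) := by
    intro x
    rw [aux_count, ← tsum_div_const]
    simp only [mul_div_assoc]
  simp only [e]
  refine tendsto_tsum_of_dominated_convergence (bound := fun d : ℕ => 1 / (d : ℝ) ^ 2) ?_ ?_ ?_
  · exact Real.summable_one_div_nat_pow.mpr (by norm_num)
  · intro d
    by_cases hd : Nat.Coprime d k
    · rcases Nat.eq_zero_or_pos d with rfl | h0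
      · simp
      · have := (auxA_tendsto m k d hk h0 hd).const_mul (moebius d : ℝ)
        convert this using 2
        rw [if_pos hd]
        field_simp
    · simp [hd, auxA_not_coprime m k d _ hcop hd]
  · refine Eventually.of_forall fun x d => ?_
    rw [norm_mul]
    have h1 : ‖(moebius d : ℝ)‖ ≤ 1 := by
      rw [Real.norm_eq_abs]
      exact_mod_cast abs_moebius_le_one (n := d)
    have h2 : ‖(auxA m k d x : ℝ) / x‖ ≤ 1 / (d : ℝ) ^ 2 := by
      rw [Real.norm_of_nonneg (by positivity)]
      exact auxA_le m k d x
    calc _ ≤ 1 * (1 / (d : ℝ) ^ 2) := mul_le_mul h1 h2 (norm_nonneg _) zero_le_one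
      _ = _ := one_mul _

theorem stmt18 (m k : ℕ) (hk : 0 < k) (hcop : Nat.Coprime m k) :
    Filter.Tendsto (fun x : ℕ =>
        (Nat.card {r : ℕ // r ∈ Finset.Icc 1 x ∧ Squarefree r ∧ r % k = m % k} : ℝ) /
          (6 * (x : ℝ) / (π ^ 2 * k) *
            ∏ p ∈ k.primeFactors, ((1 : ℝ) - 1 / (p : ℝ) ^ 2)⁻¹))
      Filter.atTop (nhds 1) := by
  have hk' : (0 : ℝ) < k := by exact_mod_cast hk
  have hP : 0 < ∏ p ∈ k.primeFactors, ((1 : ℝ) - 1 / (p : ℝ) ^ 2)⁻¹ := by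
    refine Finset.prod_pos fun p hp => inv_pos.mpr ?_
    have h2 : (2 : ℝ) ≤ p := by exact_mod_cast (Nat.prime_of_mem_primeFactors hp).two_le
    rw [sub_pos, div_lt_one (by positivity)]
    nlinarith
  have hpi := Real.pi_pos
  have h := (aux_main m k hk hcop).div_const
    ((6 / π ^ 2 * ∏ p ∈ k.primeFactors, ((1 : ℝ) - 1 / (p : ℝ) ^ 2)⁻¹) / k)
  rw [div_self (by positivity)] at h
  refine h.congr fun x => ?_
  rw [div_div]
  congr 1
  ring
end

section
/- For a fixed positive integer k, the number T(x; k) of square-free integers not exceeding x that are coprime to k satisfies T(x; k) ~ (6x/π²) · ∏_{p | k} p/(p+1) as x → ∞. -/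
open Real Filter

/-- count of n in (0,y] coprime to k -/
noncomputable def copCount (k y : ℕ) : ℕ := ((Finset.Ioc 0 y).filter (fun n => k.Coprime n)).card

lemma copCount_le (k y : ℕ) : copCount k y ≤ y := by
  unfold copCount
  exact (Finset.card_filter_le _ _).trans (by simp)

lemma copCount_add (k y : ℕ) : copCount k (y + k) = copCount k y + k.totient := by
  unfold copCount
  rw [← Nat.filter_coprime_Ico_eq_totient k (y+1)]
  rw [← Finset.card_union_of_disjoint]
  · congr 1
    ext n
    simp only [Finset.mem_filter, Finset.mem_union, Finset.mem_Ioc, Finset.mem_Ico]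
    by_cases h : k.Coprime n <;> simp [h]
    omega
  · rw [Finset.disjoint_left]
    intro n
    simp only [Finset.mem_filter, Finset.mem_Ioc, Finset.mem_Ico]
    omega

lemma copCount_bound (k : ℕ) (hk : 0 < k) (y : ℕ) :
    |(copCount k y : ℝ) - k.totient / k * y| ≤ k := by
  have hk' : (0:ℝ) < k := by exact_mod_cast hk
  induction y using Nat.strong_induction_on with
  | _ y ih =>
    by_cases h : y < k
    · have h1 : (copCount k y : ℝ) ≤ y := by exact_mod_cast copCount_le k y
      have h2 : (y : ℝ) < k := by exact_mod_cast h
      have h3 : (k.totient : ℝ) / k ≤ 1 := by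
        rw [div_le_one hk']
        exact_mod_cast Nat.totient_le k
      have h4 : (0:ℝ) ≤ (k.totient : ℝ) / k := by positivity
      have h5 : (0:ℝ) ≤ y := by positivity
      have h6 : (0:ℝ) ≤ copCount k y := by positivity
      rw [abs_le]
      constructor <;> nlinarith
    · obtain ⟨z, rfl⟩ : ∃ z, y = z + k := ⟨y - k, by omega⟩
      have := ih z (by omega)
      rw [copCount_add]
      convert this using 2
      push_cast
      field_simp
      ring

lemma sum_moebius_sq (n N : ℕ) (hn : 0 < n) (hN : n ≤ N) :
    ∑ d ∈ (Finset.Icc 1 N).filter (fun d => d ^ 2 ∣ n), ArithmeticFunction.moebius d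
      = if Squarefree n then 1 else 0 := by
  obtain ⟨a, b, hab, ha⟩ := Nat.sq_mul_squarefree n
  have hb : b ≠ 0 := by rintro rfl; simp at hab; omega
  have hdvd : ∀ d, d ^ 2 ∣ n ↔ d ∣ b := by
    intro d
    constructor
    · intro h
      have ha0 : a ≠ 0 := ha.ne_zero
      by_cases hd : d = 0
      · subst hd; simp at h; omega
      rw [← Nat.factorization_le_iff_dvd hd hb]
      intro p
      have h2 := (Nat.factorization_le_iff_dvd (by positivity) hn.ne').2 h p
      rw [← hab, Nat.factorization_mul (by positivity) ha0] at h2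
      have := (Nat.squarefree_iff_factorization_le_one ha0).1 ha p
      simp at h2
      omega
    · intro h
      rw [← hab]
      exact (pow_dvd_pow_of_dvd h 2).mul_right a
  have hbn : b ≤ N := by
    have : b ∣ n := hab ▸ ((dvd_pow_self b two_ne_zero).mul_right a)
    exact (Nat.le_of_dvd hn this).trans hN
  have hset : (Finset.Icc 1 N).filter (fun d => d ^ 2 ∣ n) = b.divisors := by
    ext d
    simp only [Finset.mem_filter, Finset.mem_Icc, hdvd, Nat.mem_divisors]
    constructor
    · rintro ⟨_, h⟩; exact ⟨h, hb⟩
    · rintro ⟨h, _⟩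
      exact ⟨⟨Nat.pos_of_dvd_of_pos h (by omega), (Nat.le_of_dvd (by omega) h).trans hbn⟩, h⟩
  rw [hset, ← ArithmeticFunction.coe_mul_zeta_apply, ArithmeticFunction.moebius_mul_coe_zeta,
    ArithmeticFunction.one_apply]
  congr 1
  rw [eq_iff_iff]
  constructor
  · rintro rfl; simpa [← hab] using ha
  · intro h
    have := h b ⟨a, by rw [← hab]; ring⟩
    simpa using this

/-- count of n in [1,x] coprime to k and divisible by d^2 -/
noncomputable def sqCount (k x d : ℕ) : ℕ :=
  ((Finset.Icc 1 x).filter (fun n => k.Coprime n ∧ d ^ 2 ∣ n)).card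

lemma sqCount_eq (k x d : ℕ) (hd : 0 < d) :
    sqCount k x d = if k.Coprime d then copCount k (x / d ^ 2) else 0 := by
  unfold sqCount copCount
  split_ifs with h
  · symm
    apply Finset.card_bij (fun m _ => d ^ 2 * m)
    · intro m hm
      simp only [Finset.mem_filter, Finset.mem_Ioc, Finset.mem_Icc] at hm ⊢
      refine ⟨⟨Nat.mul_pos (by positivity) hm.1.1, ?_⟩, ?_, dvd_mul_right _ _⟩
      · have := (Nat.le_div_iff_mul_le (by positivity)).1 hm.1.2
        linarith
      · exact Nat.Coprime.mul_right (h.pow_right 2) hm.2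
    · intro a _ b _ hab
      exact Nat.eq_of_mul_eq_mul_left (by positivity) hab
    · intro n hn
      simp only [Finset.mem_filter, Finset.mem_Icc] at hn
      obtain ⟨⟨h1, h2⟩, h3, m, rfl⟩ := hn
      refine ⟨m, ?_, rfl⟩
      simp only [Finset.mem_filter, Finset.mem_Ioc]
      refine ⟨⟨Nat.pos_of_mul_pos_left (by omega : 0 < d^2*m), ?_⟩, h3.coprime_mul_left_right⟩
      rw [Nat.le_div_iff_mul_le (by positivity)]
      linarith
  · rw [Finset.card_eq_zero, Finset.filter_eq_empty_iff]
    rintro n - ⟨h1, h2⟩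
    exact h (h1.coprime_dvd_right ((dvd_pow_self d two_ne_zero).trans h2))

lemma count_eq (k x : ℕ) :
    (Nat.card {r : ℕ // r ∈ Finset.Icc 1 x ∧ Squarefree r ∧ Nat.Coprime r k} : ℝ)
      = ∑' d : ℕ, (ArithmeticFunction.moebius d : ℝ) * sqCount k x d := by
  rw [tsum_eq_sum (s := Finset.Icc 1 x)]
  · have h1 : Nat.card {r : ℕ // r ∈ Finset.Icc 1 x ∧ Squarefree r ∧ Nat.Coprime r k}
        = ((Finset.Icc 1 x).filter (fun r => Squarefree r ∧ Nat.Coprime r k)).card := by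
      rw [Nat.subtype_card]
      intro r
      simp
    have h2 : (((Finset.Icc 1 x).filter (fun r => Squarefree r ∧ Nat.Coprime r k)).card : ℤ)
        = ∑ d ∈ Finset.Icc 1 x, ArithmeticFunction.moebius d * (sqCount k x d : ℤ) := by
      have h3 : ∀ d, ArithmeticFunction.moebius d * (sqCount k x d : ℤ)
          = ∑ n ∈ Finset.Icc 1 x, if k.Coprime n ∧ d ^ 2 ∣ n then
              ArithmeticFunction.moebius d else 0 := by
        intro d
        rw [← Finset.sum_filter, Finset.sum_const, sqCount, nsmul_eq_mul, mul_comm]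
      simp_rw [h3]
      rw [Finset.sum_comm, Finset.card_filter]
      push_cast
      refine Finset.sum_congr rfl fun n hn => ?_
      rw [Finset.mem_Icc] at hn
      have h4 := sum_moebius_sq n x (by omega) hn.2
      rw [Finset.sum_filter] at h4
      by_cases hc : k.Coprime n
      · have e1 : (Squarefree n ∧ n.Coprime k) ↔ Squarefree n := ⟨fun h => h.1, fun h => ⟨h, hc.symm⟩⟩
        rw [if_congr e1 rfl rfl, ← h4]
        exact Finset.sum_congr rfl fun d _ =>
          if_congr ⟨fun h => ⟨hc, h⟩, fun h => h.2⟩ rfl rfl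
      · have hc' : ¬ n.Coprime k := fun h => hc h.symm
        rw [if_neg (fun h => hc' h.2)]
        exact (Finset.sum_eq_zero fun d _ => if_neg (fun h => hc h.1)).symm
    rw [h1]
    exact_mod_cast h2
  · intro d hd
    simp only [Finset.mem_Icc, not_and, not_le] at hd
    rcases Nat.eq_zero_or_pos d with rfl | hd0
    · simp
    · have : x / d ^ 2 = 0 := by
        apply Nat.div_eq_of_lt
        nlinarith [hd hd0]
      rw [sqCount_eq _ _ _ hd0, this]
      simp [copCount]

lemma series_complex (k : ℕ) (hk : 0 < k) :
    (∏ p ∈ k.primeFactors, (1 - ((p : ℝ) ^ 2)⁻¹)) * (π ^ 2 / 6) *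
    (∑' d : ℕ, (ArithmeticFunction.moebius d : ℝ) *
      (if k.Coprime d then (1 / (d:ℝ) ^ 2) else 0)) = 1 := by
  have : NeZero k := ⟨hk.ne'⟩
  have h := DirichletCharacter.LSeries.mul_mu_eq_one (1 : DirichletCharacter ℂ k) (s := 2)
    (by norm_num)
  rw [← DirichletCharacter.LFunction_eq_LSeries _ (by norm_num)] at h
  have h2 := DirichletCharacter.LFunctionTrivChar_eq_mul_riemannZeta (N := k) (s := 2)
    (by norm_num)
  rw [DirichletCharacter.LFunctionTrivChar] at h2
  rw [h2, riemannZeta_two] at h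
  have h3 : LSeries ((fun n : ℕ => (1 : DirichletCharacter ℂ k) n) *
      fun n : ℕ => (ArithmeticFunction.moebius n : ℂ)) 2
      = ((∑' d : ℕ, (ArithmeticFunction.moebius d : ℝ) *
      (if k.Coprime d then (1 / (d:ℝ) ^ 2) else 0) : ℝ) : ℂ) := by
    rw [LSeries, Complex.ofReal_tsum]
    refine tsum_congr fun d => ?_
    rcases Nat.eq_zero_or_pos d with rfl | hd
    · simp
    rw [LSeries.term_of_ne_zero hd.ne']
    by_cases hc : k.Coprime d
    · have : IsUnit (d : ZMod k) := (ZMod.isUnit_iff_coprime d k).2 hc.symm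
      rw [if_pos hc]
      simp [MulChar.one_apply this, div_eq_mul_inv]
    · have : ¬ IsUnit (d : ZMod k) := fun h => hc ((ZMod.isUnit_iff_coprime d k).1 h).symm
      rw [if_neg hc]
      simp [MulChar.map_nonunit _ this]
  rw [h3] at h
  have h5 : ∀ p : ℕ, (p : ℂ) ^ (-2 : ℂ) = ((p : ℂ) ^ 2)⁻¹ := by
    intro p
    rw [Complex.cpow_neg]
    norm_num
  simp only [h5] at h
  apply Complex.ofReal_injective
  rw [Complex.ofReal_mul, Complex.ofReal_mul, Complex.ofReal_prod]
  push_cast [-Complex.ofReal_tsum]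
  exact h

lemma series_value (k : ℕ) (hk : 0 < k) :
    (∑' d : ℕ, (ArithmeticFunction.moebius d : ℝ) *
      (if k.Coprime d then (k.totient / k : ℝ) * (1 / (d:ℝ) ^ 2) else 0))
      = 6 / π ^ 2 * ∏ p ∈ k.primeFactors, (p : ℝ) / ((p : ℝ) + 1) := by
  have h := series_complex k hk
  have hk' : (k : ℝ) ≠ 0 := by exact_mod_cast hk.ne'
  have h1 : (k.totient / k : ℝ) = ∏ p ∈ k.primeFactors, (1 - (p : ℝ)⁻¹) := by
    have := Nat.totient_eq_mul_prod_factors k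
    have : (k.totient : ℝ) = k * ∏ p ∈ k.primeFactors, (1 - (p : ℝ)⁻¹) := by
      have h := congrArg (fun q : ℚ => (q : ℝ)) this
      push_cast at h
      exact h
    rw [this]
    field_simp
  have h2 : (k.totient / k : ℝ) = (∏ p ∈ k.primeFactors, (1 - ((p : ℝ) ^ 2)⁻¹)) *
      ∏ p ∈ k.primeFactors, (p : ℝ) / ((p : ℝ) + 1) := by
    rw [h1, ← Finset.prod_mul_distrib]
    refine Finset.prod_congr rfl fun p hp => ?_
    have : (0:ℝ) < p := by exact_mod_cast (Nat.prime_of_mem_primeFactors hp).pos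
    field_simp
    ring
  have h3 : (∑' d : ℕ, (ArithmeticFunction.moebius d : ℝ) *
      (if k.Coprime d then (k.totient / k : ℝ) * (1 / (d:ℝ) ^ 2) else 0))
      = (k.totient / k : ℝ) * (∑' d : ℕ, (ArithmeticFunction.moebius d : ℝ) *
      (if k.Coprime d then (1 / (d:ℝ) ^ 2) else 0)) := by
    rw [← tsum_mul_left]
    refine tsum_congr fun d => ?_
    split_ifs <;> ring
  rw [h3, h2]
  set S := (∑' d : ℕ, (ArithmeticFunction.moebius d : ℝ) *
      (if k.Coprime d then (1 / (d:ℝ) ^ 2) else 0))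
  set P := (∏ p ∈ k.primeFactors, (1 - ((p : ℝ) ^ 2)⁻¹))
  have hpi : (π : ℝ) ≠ 0 := Real.pi_ne_zero
  have : P * S = 6 / π ^ 2 := by
    field_simp
    linarith
  rw [← this]
  ring

lemma sqCount_tendsto (k : ℕ) (hk : 0 < k) (d : ℕ) (hd : 0 < d) :
    Tendsto (fun x : ℕ => (sqCount k x d : ℝ) / x) atTop
      (nhds (if k.Coprime d then (k.totient / k : ℝ) * (1 / (d:ℝ) ^ 2) else 0)) := by
  split_ifs with h
  · rw [tendsto_iff_norm_sub_tendsto_zero]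
    refine squeeze_zero' (g := fun x : ℕ => (k + 1 : ℝ) / x)
      (Eventually.of_forall fun _ => norm_nonneg _) ?_ (tendsto_const_div_atTop_nhds_zero_nat _)
    filter_upwards [eventually_gt_atTop 0] with x hx
    have hx' : (0:ℝ) < x := by exact_mod_cast hx
    have hd' : (0:ℝ) < d := by exact_mod_cast hd
    have hk' : (0:ℝ) < k := by exact_mod_cast hk
    rw [sqCount_eq _ _ _ hd, if_pos h, Real.norm_eq_abs]
    have e : (copCount k (x / d ^ 2) : ℝ) / x - k.totient / k * (1 / (d:ℝ) ^ 2)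
        = ((copCount k (x / d ^ 2) : ℝ) - k.totient / k * (x / (d:ℝ) ^ 2)) / x := by
      field_simp
    rw [e, abs_div, abs_of_pos hx']
    gcongr
    have b := copCount_bound k hk (x / d ^ 2)
    have h3 : (k.totient : ℝ) / k ≤ 1 := by
      rw [div_le_one hk']
      exact_mod_cast Nat.totient_le k
    have h4 : (0:ℝ) ≤ (k.totient : ℝ) / k := by positivity
    have h5 : ((x / d ^ 2 : ℕ) : ℝ) ≤ x / (d:ℝ) ^ 2 := by
      have := @Nat.cast_div_le ℝ _ _ _ x (d ^ 2)
      push_cast at this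
      exact this
    have h6 : (x : ℝ) / (d:ℝ) ^ 2 ≤ ((x / d ^ 2 : ℕ) : ℝ) + 1 := by
      rw [div_le_iff₀ (by positivity)]
      have := (Nat.lt_mul_div_succ x (show 0 < d ^ 2 by positivity)).le
      rw [mul_comm] at this
      exact_mod_cast this
    rw [abs_le] at b ⊢
    constructor <;> nlinarith
  · simp [sqCount_eq _ _ _ hd, h]

theorem stmt19_aux (k : ℕ) (hk : 0 < k) :
    Tendsto (fun x : ℕ =>
        (Nat.card {r : ℕ // r ∈ Finset.Icc 1 x ∧ Squarefree r ∧ Nat.Coprime r k} : ℝ) / x)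
      atTop (nhds (6 / π ^ 2 * ∏ p ∈ k.primeFactors, (p : ℝ) / ((p : ℝ) + 1))) := by
  rw [← series_value k hk]
  simp_rw [count_eq, ← tsum_div_const, mul_div_assoc]
  refine tendsto_tsum_of_dominated_convergence (bound := fun d : ℕ => 1 / (d:ℝ) ^ 2)
    (Real.summable_one_div_nat_pow.2 one_lt_two) ?_ ?_
  · intro d
    rcases Nat.eq_zero_or_pos d with rfl | hd
    · simp
    · exact (sqCount_tendsto k hk d hd).const_mul _
  · filter_upwards [eventually_gt_atTop 0] with x hx d
    have hx' : (0:ℝ) < x := by exact_mod_cast hx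
    rcases Nat.eq_zero_or_pos d with rfl | hd
    · simp
    have hm : |(ArithmeticFunction.moebius d : ℝ)| ≤ 1 := by
      exact_mod_cast ArithmeticFunction.abs_moebius_le_one (n := d)
    have hs : (sqCount k x d : ℝ) ≤ x / (d:ℝ) ^ 2 := by
      have h1 : sqCount k x d ≤ x / d ^ 2 := by
        rw [sqCount_eq _ _ _ hd]
        split_ifs
        · exact copCount_le _ _
        · exact Nat.zero_le _
      have h2 := @Nat.cast_div_le ℝ _ _ _ x (d ^ 2)
      push_cast at h2
      exact le_trans (by exact_mod_cast h1) h2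
    rw [Real.norm_eq_abs, abs_mul, abs_of_nonneg (a := (sqCount k x d : ℝ) / x) (by positivity)]
    calc _ ≤ 1 * ((sqCount k x d : ℝ) / x) := by gcongr
      _ ≤ 1 * ((x / (d:ℝ) ^ 2) / x) := by gcongr
      _ = _ := by field_simp

theorem stmt19 (k : ℕ) (hk : 0 < k) :
    Filter.Tendsto (fun x : ℕ =>
        (Nat.card {r : ℕ // r ∈ Finset.Icc 1 x ∧ Squarefree r ∧ Nat.Coprime r k} : ℝ) /
          (6 * (x : ℝ) / π ^ 2 * ∏ p ∈ k.primeFactors, (p : ℝ) / ((p : ℝ) + 1)))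
      Filter.atTop (nhds 1) := by
  have h := stmt19_aux k hk
  have hP : (∏ p ∈ k.primeFactors, (p : ℝ) / ((p : ℝ) + 1)) ≠ 0 := by
    refine Finset.prod_ne_zero_iff.2 fun p hp => ?_
    have : (0:ℝ) < p := by exact_mod_cast (Nat.prime_of_mem_primeFactors hp).pos
    positivity
  have hL : (6 / π ^ 2 * ∏ p ∈ k.primeFactors, (p : ℝ) / ((p : ℝ) + 1)) ≠ 0 :=
    mul_ne_zero (by positivity) hP
  have h2 := h.div_const (6 / π ^ 2 * ∏ p ∈ k.primeFactors, (p : ℝ) / ((p : ℝ) + 1))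
  rw [div_self hL] at h2
  refine h2.congr fun x => ?_
  rw [div_div]
  congr 1
  ring
end
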